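/- arXiv:2602.09607 — 14 statements merged into one kernel-verified Lean document; each statement's English description precedes it below -/
import Mathlib

section
/- For all positive integers n, m with m ≤ n, we have h(n,m) ≥ ⌈n/2⌉. -/
/-- The generalized binomial coefficient `C(a,k) = a(a-1)⋯(a-k+1)/k!` for an integer `a`
and natural number `k`, as a rational number. -/
def genChoose (a : ℤ) (k : ℕ) : ℚ :=
  (∏ i ∈ Finset.range k, ((a : ℚ) - i)) / (Nat.factorial k)

/-- `hNM n m` is the maximum of the set of `q ∈ ℕ` with `q ≤ n + m` such that
`C(q-n, 2ℓ) + C(q-m, 2ℓ) ≥ C(q, 2ℓ)` for all integers `ℓ` with `1 ≤ ℓ ≤ ⌊q/2⌋`.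
For `n ≥ m ≥ 1` it equals the Hilbert depth of `S_{n,m}/I_{n,m}`. -/
noncomputable def hNM (n m : ℕ) : ℕ :=
  sSup {q : ℕ | q ≤ n + m ∧ ∀ ℓ : ℕ, 1 ≤ ℓ → ℓ ≤ q / 2 →
    genChoose (q : ℤ) (2 * ℓ) ≤
      genChoose ((q : ℤ) - n) (2 * ℓ) + genChoose ((q : ℤ) - m) (2 * ℓ)}

theorem genChoose_natCast (a k : ℕ) : genChoose (a : ℤ) k = a.choose k := by
  rw [genChoose, Nat.choose_eq_descFactorial_div_factorial,
    Nat.cast_div (Nat.factorial_dvd_descFactorial a k) (by positivity),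
    ← descPochhammer_eval_eq_descFactorial ℚ, descPochhammer_eval_eq_prod_range, Int.cast_natCast]

theorem genChoose_neg_natCast (a k : ℕ) :
    genChoose (-(a : ℤ)) k = (-1) ^ k * (a + k - 1).choose k := by
  have hprod : ∏ i ∈ Finset.range k, (((-(a : ℤ) : ℤ) : ℚ) - i) =
      (-1) ^ k * a.ascFactorial k := by
    rw [Nat.ascFactorial_eq_prod_range, Nat.cast_prod, ← Finset.card_range k,
      ← Finset.prod_const, Finset.card_range, ← Finset.prod_mul_distrib]
    refine Finset.prod_congr rfl fun i _ => ?_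
    push_cast
    ring
  rw [genChoose, hprod, Nat.choose_eq_asc_factorial_div_factorial',
    Nat.cast_div (Nat.factorial_dvd_ascFactorial a k) (by positivity), mul_div_assoc]

theorem genChoose_nonneg_of_even (a : ℤ) {k : ℕ} (hk : Even k) : 0 ≤ genChoose a k := by
  obtain ⟨b, rfl | rfl⟩ := a.eq_nat_or_neg
  · rw [genChoose_natCast]
    positivity
  · rw [genChoose_neg_natCast, hk.neg_one_pow]
    positivity

/-- For all positive integers n, m with m ≤ n, we have h(n,m) ≥ ⌈n/2⌉. -/
theorem hNM_ge_ceil_half (n m : ℕ) (hm : 1 ≤ m) (hmn : m ≤ n) :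
    (n + 1) / 2 ≤ hNM n m := by
  refine le_csSup ⟨n + m, fun q hq => hq.1⟩ ⟨by omega, fun ℓ hℓ _ => ?_⟩
  have hsub : (((n + 1) / 2 : ℕ) : ℤ) - n = -((n / 2 : ℕ) : ℤ) := by omega
  have hchoose : ((n + 1) / 2).choose (2 * ℓ) ≤ (n / 2 + 2 * ℓ - 1).choose (2 * ℓ) :=
    Nat.choose_le_choose _ (by omega)
  have hnonneg := genChoose_nonneg_of_even (((n + 1) / 2 : ℕ) - (m : ℤ)) (even_two_mul ℓ)
  rw [hsub, genChoose_neg_natCast, genChoose_natCast, (even_two_mul ℓ).neg_one_pow, one_mul]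
  exact le_add_of_le_of_nonneg (by exact_mod_cast hchoose) hnonneg
end

section
/- Let s ≥ 1 and t be integers with n = 2s + 1 and m = s + 1 + t, where 1 ≤ m ≤ n. If t lies in the open interval ((1 − √(9+16s))/2, (1 + √(9+16s))/2) (equivalently, t² − t − 4s − 2 < 0), then h(n,m) = s + 1. -/
theorem genChoose_eq_choose (a : ℤ) (k : ℕ) : genChoose a k = (Ring.choose a k : ℤ) := by
  have h := Ring.descPochhammer_eq_factorial_smul_choose a k
  rw [← Polynomial.eval_eq_smeval, descPochhammer_eval_eq_prod_range] at h
  have h' : (∏ i ∈ Finset.range k, ((a : ℚ) - i)) = k.factorial * (Ring.choose a k : ℤ) := by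
    have := congrArg (Int.cast : ℤ → ℚ) h
    simpa using this
  rw [genChoose, h', mul_div_cancel_left₀ _ (by positivity)]

theorem genChoose_natCast_s2 (N k : ℕ) : genChoose (N : ℤ) k = N.choose k := by
  rw [genChoose_eq_choose, Ring.choose_natCast]
  norm_cast

theorem genChoose_neg_natCast_even (N l : ℕ) :
    genChoose (-(N : ℤ)) (2 * l) = (N + 2 * l - 1).choose (2 * l) := by
  rcases Nat.eq_zero_or_pos l with rfl | hl
  · simp [genChoose]
  · have h : (N : ℤ) + (2 * l : ℕ) - 1 = (N + 2 * l - 1 : ℕ) := by omega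
    rw [genChoose_eq_choose, Ring.choose_neg, h, Ring.choose_natCast]
    simp [Int.negOnePow_even]

theorem genChoose_even_nonneg (a : ℤ) (l : ℕ) : 0 ≤ genChoose a (2 * l) := by
  obtain ⟨N, rfl | rfl⟩ := a.eq_nat_or_neg
  · rw [genChoose_natCast_s2]; positivity
  · rw [genChoose_neg_natCast_even]; positivity

theorem genChoose_two (a : ℤ) : genChoose a 2 = a * (a - 1) / 2 := by
  simp [genChoose, Finset.prod_range_succ]

/-- If n = 2s+1, m = s+1+t with 1 ≤ m ≤ n and
t ∈ ((1 − √(9+16s))/2, (1 + √(9+16s))/2), then h(n,m) = s + 1. -/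
theorem hNM_eq_of_odd (s : ℕ) (hs : 1 ≤ s) (t : ℤ) (n m : ℕ)
    (hn : n = 2 * s + 1) (hm : (m : ℤ) = (s : ℤ) + 1 + t) (hm1 : 1 ≤ m) (hmn : m ≤ n)
    (ht1 : (1 - Real.sqrt (9 + 16 * s)) / 2 < (t : ℝ))
    (ht2 : (t : ℝ) < (1 + Real.sqrt (9 + 16 * s)) / 2) :
    hNM n m = s + 1 := by
  have htq : t ^ 2 - t - 4 * s - 2 < 0 := by
    have hsq : Real.sqrt (9 + 16 * s) ^ 2 = 9 + 16 * s := Real.sq_sqrt (by positivity)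
    have h : (t : ℝ) ^ 2 - t - 4 * s - 2 < 0 := by nlinarith
    exact_mod_cast h
  refine IsGreatest.csSup_eq ⟨⟨by omega, fun l hl hl2 => ?_⟩, fun q ⟨hq, hall⟩ => ?_⟩
  · have hsub : ((s + 1 : ℕ) : ℤ) - n = -(s : ℤ) := by omega
    rw [hsub, genChoose_natCast_s2, genChoose_neg_natCast_even]
    have hle : ((s + 1).choose (2 * l) : ℚ) ≤ (s + 2 * l - 1).choose (2 * l) := by
      exact_mod_cast Nat.choose_le_choose _ (by omega)
    linarith [genChoose_even_nonneg (((s + 1 : ℕ) : ℤ) - m) l]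
  · by_contra! hlt
    have h := hall 1 le_rfl (by omega)
    simp only [mul_one, genChoose_two] at h
    have hz : (q : ℤ) * (q - 1) ≤ (q - n) * (q - n - 1) + (q - m) * (q - m - 1) := by
      have h' : (q : ℚ) * (q - 1) ≤ (q - n) * (q - n - 1) + (q - m) * (q - m - 1) := by
        push_cast at h
        linarith
      exact_mod_cast h'
    have hq2 : (s : ℤ) + 2 ≤ q := by omega
    have hq' : (q : ℤ) ≤ n + m := by omega
    have hs2 : (s : ℤ) + 2 ≤ n + m := by omega
    have hmul : 0 ≤ ((q : ℤ) - (s + 2)) * (2 * (n + m) + 1 - q - (s + 2)) :=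
      mul_nonneg (by omega) (by omega)
    have hn' : (n : ℤ) = 2 * s + 1 := by omega
    rw [hn', hm] at hz hmul
    nlinarith
end

section
/- For every integer n ≥ 2, we have h(n,n) ≥ ⌊ n/2 + √(⌊n/2⌋ · ln 2) ⌋ − 1, where ln 2 denotes the natural logarithm of 2. -/
theorem sum_max_sub_two_mul_le (k : ℕ) (m : ℝ) :
    ∑ i ∈ Finset.range k, max 0 (m - 2 * (i : ℝ)) ≤ (m + 1) ^ 2 / 4 := by
  induction k generalizing m with
  | zero => simp; positivity
  | succ k ih =>
    rcases le_total 0 m with hm | hm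
    · have h := ih (m - 2)
      have hs : ∀ i ∈ Finset.range k,
          max 0 (m - 2 * ((i + 1 : ℕ) : ℝ)) = max 0 (m - 2 - 2 * (i : ℝ)) := by
        intro i _
        congr 1
        push_cast
        ring
      rw [Finset.sum_range_succ', Finset.sum_congr rfl hs, Nat.cast_zero, mul_zero, sub_zero,
        max_eq_right hm]
      linarith
    · have hs : ∀ i ∈ Finset.range (k + 1), max 0 (m - 2 * (i : ℝ)) = 0 := by
        intro i _
        have : (0 : ℝ) ≤ i := i.cast_nonneg
        exact max_eq_left (by linarith)
      rw [Finset.sum_eq_zero hs]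
      positivity

/-- Comparison of a falling product from `q` with a rising product from `d`. -/
theorem prod_sub_le_two_mul_prod_add {q d : ℝ} {k : ℕ} (hd : 0 < d) (hk : (k : ℝ) ≤ q)
    (h : ∑ i ∈ Finset.range k, max 0 (q - d - 2 * (i : ℝ)) ≤ d * Real.log 2) :
    ∏ i ∈ Finset.range k, (q - i) ≤ 2 * ∏ i ∈ Finset.range k, (d + i) := by
  have hfactor : ∏ i ∈ Finset.range k, (q - i) ≤
      ∏ i ∈ Finset.range k, ((d + i) * Real.exp (max 0 (q - d - 2 * (i : ℝ)) / d)) := by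
    refine Finset.prod_le_prod (fun i hi => ?_) (fun i _ => ?_)
    · have : (i : ℝ) ≤ k := by exact_mod_cast (Finset.mem_range.mp hi).le
      linarith
    · set x := max 0 (q - d - 2 * (i : ℝ))
      have hx : 0 ≤ x := le_max_left _ _
      have hx' : q - d - 2 * (i : ℝ) ≤ x := le_max_right _ _
      have hi : (0 : ℝ) ≤ i := i.cast_nonneg
      calc q - i ≤ d + i + x := by linarith
        _ ≤ d + i + x + i * (x / d) := le_add_of_nonneg_right (by positivity)
        _ = (d + i) * (x / d + 1) := by field_simp; ring
        _ ≤ (d + i) * Real.exp (x / d) := by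
          gcongr
          exact Real.add_one_le_exp _
  have hexp : Real.exp ((∑ i ∈ Finset.range k, max 0 (q - d - 2 * (i : ℝ))) / d) ≤ 2 := by
    rw [← Real.le_log_iff_exp_le two_pos, div_le_iff₀ hd]
    linarith
  rw [Finset.prod_mul_distrib, ← Real.exp_sum, ← Finset.sum_div] at hfactor
  refine hfactor.trans ?_
  rw [mul_comm]
  exact mul_le_mul_of_nonneg_right hexp (Finset.prod_nonneg fun i _ => by positivity)

theorem genChoose_neg_two_mul (d : ℤ) (l : ℕ) :
    genChoose (-d) (2 * l) =
      (∏ i ∈ Finset.range (2 * l), ((d : ℚ) + i)) / (Nat.factorial (2 * l)) := by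
  have h : ∀ i ∈ Finset.range (2 * l), (((-d : ℤ) : ℚ) - i) = -((d : ℚ) + i) := by
    intro i _
    push_cast
    ring
  rw [genChoose, Finset.prod_congr rfl h, Finset.prod_neg]
  simp

theorem le_hNM_diag {n q : ℕ} (hqn : q < n)
    (h : ∀ k ≤ q, ∑ i ∈ Finset.range k, max 0 ((q : ℝ) - (n - q) - 2 * (i : ℝ)) ≤
      ((n : ℝ) - q) * Real.log 2) :
    q ≤ hNM n n := by
  refine le_csSup ⟨n + n, fun _ hx => hx.1⟩ ⟨by omega, fun l _ hl => ?_⟩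
  have hk : 2 * l ≤ q := by omega
  have hd : (0 : ℝ) < (n : ℝ) - q := sub_pos.mpr (by exact_mod_cast hqn)
  have hprod := prod_sub_le_two_mul_prod_add hd (by exact_mod_cast hk) (h _ hk)
  have hprodQ : ∏ i ∈ Finset.range (2 * l), ((q : ℚ) - i) ≤
      2 * ∏ i ∈ Finset.range (2 * l), (((n - q : ℤ) : ℚ) + i) := by
    have hcast : ((∏ i ∈ Finset.range (2 * l), ((q : ℚ) - i) : ℚ) : ℝ) ≤
        ((2 * ∏ i ∈ Finset.range (2 * l), (((n - q : ℤ) : ℚ) + i) : ℚ) : ℝ) := by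
      push_cast
      exact hprod
    exact_mod_cast hcast
  rw [show (q : ℤ) - n = -((n : ℤ) - q) by ring, genChoose_neg_two_mul, genChoose,
    ← add_div, ← two_mul]
  gcongr
  exact_mod_cast hprodQ

/-- For every integer n ≥ 2, h(n,n) ≥ ⌊ n/2 + √(⌊n/2⌋ · ln 2) ⌋ − 1. -/
theorem hNM_diag_lower_bound (n : ℕ) (hn : 2 ≤ n) :
    (⌊(n : ℝ) / 2 + Real.sqrt (((n / 2 : ℕ) : ℝ) * Real.log 2)⌋ - 1 : ℤ) ≤ (hNM n n : ℤ) := by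
  set s := Real.sqrt (((n / 2 : ℕ) : ℝ) * Real.log 2) with hs
  have hlog : 0 < Real.log 2 := Real.log_pos one_lt_two
  have hlog1 : Real.log 2 < 1 := by linarith [Real.log_two_lt_d9]
  have hs0 : 0 ≤ s := Real.sqrt_nonneg _
  have hn2 : (2 : ℝ) ≤ n := by exact_mod_cast hn
  have hs2 : s ^ 2 ≤ (n : ℝ) / 2 * Real.log 2 := by
    rw [hs, Real.sq_sqrt (by positivity)]
    gcongr
    exact_mod_cast Nat.cast_div_le (α := ℝ) (m := n) (n := 2)
  have hfloor : 1 ≤ ⌊(n : ℝ) / 2 + s⌋ := Int.le_floor.mpr (by push_cast; linarith)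
  obtain ⟨q, hq⟩ := Int.eq_ofNat_of_zero_le (sub_nonneg.mpr hfloor)
  rw [hq]
  have hqs : (q : ℝ) + 1 ≤ n / 2 + s := by
    have hcast : ((q : ℤ) : ℝ) = (⌊(n : ℝ) / 2 + s⌋ : ℝ) - 1 := by
      rw [← hq]
      push_cast
      ring
    have := Int.floor_le ((n : ℝ) / 2 + s)
    push_cast at hcast
    linarith
  have hqn : (q : ℝ) < n := by nlinarith [sq_nonneg (s - 1)]
  refine Int.ofNat_le.mpr (le_hNM_diag (by exact_mod_cast hqn) fun k _ => ?_)
  rcases le_total (n : ℝ) (2 * q) with hm | hm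
  · refine (sum_max_sub_two_mul_le k _).trans ?_
    have hsq : ((q : ℝ) - n / 2 + 1) ^ 2 ≤ s ^ 2 := by
      have : (q : ℝ) - n / 2 + 1 ≤ s := by linarith
      gcongr
      linarith
    nlinarith [mul_nonneg (sub_nonneg.mpr hm) (sub_nonneg.mpr hlog1.le)]
  · rw [Finset.sum_eq_zero fun i _ => max_eq_left ?_]
    · exact mul_nonneg (by linarith) hlog.le
    · have : (0 : ℝ) ≤ i := i.cast_nonneg
      linarith
end

section
/- For all positive integers n, m, m' with 1 ≤ m ≤ m' ≤ ⌊n/2⌋, we have h(n,m) ≥ h(n,m'). -/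
theorem genChoose_natCast_s5 (x k : ℕ) : genChoose (x : ℤ) k = (x.choose k : ℚ) := by
  rw [Nat.choose_eq_descFactorial_div_factorial,
    Nat.cast_div (Nat.factorial_dvd_descFactorial x k) (by exact_mod_cast k.factorial_ne_zero),
    ← descPochhammer_eval_eq_descFactorial, descPochhammer_eval_eq_prod_range]
  simp [genChoose]

theorem genChoose_neg_even (x : ℤ) (l : ℕ) :
    genChoose (-x) (2 * l) =
      (∏ i ∈ Finset.range (2 * l), ((x : ℚ) + i)) / (Nat.factorial (2 * l)) := by
  have h : ∀ i ∈ Finset.range (2 * l), (((-x : ℤ) : ℚ) - i) = -1 * ((x : ℚ) + i) := by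
    intro i _
    push_cast
    ring
  rw [genChoose, Finset.prod_congr rfl h, Finset.prod_mul_distrib]
  simp

theorem genChoose_mono_of_nonneg {a b : ℤ} (ha : 0 ≤ a) (hab : a ≤ b) (k : ℕ) :
    genChoose a k ≤ genChoose b k := by
  lift a to ℕ using ha
  lift b to ℕ using by omega
  rw [genChoose_natCast_s5, genChoose_natCast_s5]
  exact_mod_cast Nat.choose_le_choose k (by omega)

theorem genChoose_le_genChoose_neg {a x : ℤ} (hax : a ≤ x) {l : ℕ} (hl : 2 * l ≤ a) :
    genChoose a (2 * l) ≤ genChoose (-x) (2 * l) := by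
  rw [genChoose_neg_even, genChoose]
  gcongr with i hi
  · intro i hi
    have : (i : ℤ) ≤ a := by
      have := Finset.mem_range.mp hi
      omega
    exact sub_nonneg.mpr (by exact_mod_cast this)
  · have : (a : ℚ) ≤ x := by exact_mod_cast hax
    have : (0 : ℚ) ≤ i := by positivity
    linarith

/-- The inequality for `ℓ = 1` already forces `q ≤ n`. -/
theorem le_of_genChoose_two_le {n m q : ℕ} (hm : 1 ≤ m) (hmn : m ≤ n) (hq : q ≤ n + m)
    (h : genChoose (q : ℤ) 2 ≤ genChoose ((q : ℤ) - n) 2 + genChoose ((q : ℤ) - m) 2) :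
    q ≤ n := by
  by_contra! hnq
  simp only [genChoose, Finset.prod_range_succ, Finset.prod_range_zero] at h
  norm_num at h
  obtain ⟨a, rfl⟩ := Nat.exists_eq_add_of_lt hnq
  obtain ⟨c, rfl⟩ := Nat.exists_eq_add_of_le hmn
  obtain ⟨d, rfl⟩ := Nat.exists_eq_add_of_le (show a + 1 ≤ m by omega)
  push_cast at h
  have ha : (0 : ℚ) ≤ a := by positivity
  have hc : (0 : ℚ) ≤ c := by positivity
  have hd : (0 : ℚ) ≤ d := by positivity
  nlinarith [mul_nonneg ha hc, mul_nonneg ha hd, mul_nonneg hc hd, mul_nonneg ha ha,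
    mul_nonneg hd hd]

/-- For 1 ≤ m ≤ m' ≤ ⌊n/2⌋, we have h(n,m) ≥ h(n,m'). -/
theorem hNM_antitone_below (n m m' : ℕ) (hn : 1 ≤ n) (hm : 1 ≤ m) (hmm' : m ≤ m')
    (hm' : m' ≤ n / 2) :
    hNM n m' ≤ hNM n m := by
  refine csSup_le ⟨0, Nat.zero_le _, fun ℓ h1 h2 => by omega⟩ ?_
  rintro q ⟨hq, h⟩
  have hqn : q ≤ n := by
    by_contra! hnq
    exact absurd (le_of_genChoose_two_le (by omega) (by omega) hq (h 1 le_rfl (by omega)))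
      (by omega)
  refine le_csSup ⟨n + m, fun _ hx => hx.1⟩ ⟨by omega, fun ℓ h1 h2 => ?_⟩
  by_cases hqm : m' ≤ q
  · exact (h ℓ h1 h2).trans
      (by gcongr; exact genChoose_mono_of_nonneg (by omega) (by omega) _)
  · have hle := genChoose_le_genChoose_neg (a := q) (x := n - q) (l := ℓ) (by omega) (by omega)
    rw [neg_sub] at hle
    exact hle.trans (le_add_of_nonneg_right (genChoose_even_nonneg _ _))
end

section
/- Let m : ℕ → ℕ be any function such that 1 ≤ m(n) ≤ n for all n ≥ 1. Then the sequence h(n, m(n))/n converges to 1/2 as n → ∞. -/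
open Filter Topology

lemma cast_genChoose (a : ℤ) (k : ℕ) :
    (genChoose a k : ℝ) = (descPochhammer ℝ k).eval (a : ℝ) / k.factorial := by
  rw [descPochhammer_eval_eq_prod_range, genChoose]
  push_cast
  rfl

lemma genChoose_le_add_iff (a b c : ℤ) (k : ℕ) :
    genChoose a k ≤ genChoose b k + genChoose c k ↔
      (descPochhammer ℝ k).eval (a : ℝ) ≤
        (descPochhammer ℝ k).eval (b : ℝ) + (descPochhammer ℝ k).eval (c : ℝ) := by
  rw [← Rat.cast_le (K := ℝ), Rat.cast_add, cast_genChoose, cast_genChoose, cast_genChoose,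
    ← add_div, div_le_div_iff_of_pos_right (by positivity)]

/-- Reflection of an even falling factorial into a rising one. -/
lemma descPochhammer_two_mul_eval_neg (x : ℝ) (l : ℕ) :
    (descPochhammer ℝ (2 * l)).eval (-x) = ∏ i ∈ Finset.range (2 * l), (x + i) := by
  rw [descPochhammer_eval_eq_prod_range]
  calc ∏ i ∈ Finset.range (2 * l), (-x - i)
      = ∏ i ∈ Finset.range (2 * l), (-1) * (x + (i : ℝ)) :=
        Finset.prod_congr rfl fun i _ => by ring
    _ = _ := by rw [Finset.prod_mul_distrib]; simp

lemma descPochhammer_two_mul_eval_int_nonneg (a : ℤ) (l : ℕ) :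
    0 ≤ (descPochhammer ℝ (2 * l)).eval (a : ℝ) := by
  obtain ⟨n, rfl | rfl⟩ := a.eq_nat_or_neg
  · rw [Int.cast_natCast, descPochhammer_eval_eq_descFactorial]
    positivity
  · rw [Int.cast_neg, Int.cast_natCast, descPochhammer_two_mul_eval_neg]
    positivity

lemma descPochhammer_eval_natCast_pos {q k : ℕ} (hk : k ≤ q) :
    0 < (descPochhammer ℝ k).eval (q : ℝ) := by
  rw [descPochhammer_eval_eq_descFactorial]
  exact_mod_cast Nat.descFactorial_pos.2 hk

/-- Lowering the upper argument by at least one costs at least the factor `1 - k / q`. -/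
lemma mul_descPochhammer_eval_sub_le {q m k : ℕ} (hm : 1 ≤ m) (hmq : m ≤ q) (hk : k ≤ q) :
    (q : ℝ) * (descPochhammer ℝ k).eval ((q : ℝ) - m) ≤
      (q - k) * (descPochhammer ℝ k).eval (q : ℝ) := by
  obtain ⟨p, rfl⟩ : ∃ p, q = p + 1 := ⟨q - 1, by omega⟩
  rw [← Nat.cast_sub hmq, ← Nat.cast_sub hk, descPochhammer_eval_eq_descFactorial,
    descPochhammer_eval_eq_descFactorial]
  have h : (p + 1) * (p + 1 - m).descFactorial k ≤
      (p + 1 - k) * (p + 1).descFactorial k := by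
    rw [Nat.succ_descFactorial]
    exact Nat.mul_le_mul_left _ (Nat.descFactorial_le _ (by omega))
  exact_mod_cast h

lemma descPochhammer_eval_sub_le_pow_mul {n q l : ℕ} {r : ℝ} (hqn : q ≤ n)
    (h : ∀ i < 2 * l, (n : ℝ) - q + i ≤ r * (q - i)) :
    (descPochhammer ℝ (2 * l)).eval ((q : ℝ) - n) ≤
      r ^ (2 * l) * (descPochhammer ℝ (2 * l)).eval (q : ℝ) := by
  have hqn' : (q : ℝ) ≤ n := by exact_mod_cast hqn
  rw [← neg_sub (n : ℝ) q, descPochhammer_two_mul_eval_neg, descPochhammer_eval_eq_prod_range]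
  calc ∏ i ∈ Finset.range (2 * l), ((n : ℝ) - q + i)
      ≤ ∏ i ∈ Finset.range (2 * l), r * ((q : ℝ) - i) :=
        Finset.prod_le_prod (fun i _ => by have := i.cast_nonneg (α := ℝ); linarith)
          fun i hi => h i (Finset.mem_range.1 hi)
    _ = _ := by rw [Finset.prod_mul_distrib]; simp

/-- The set of admissible `q` in the definition of `hNM n m`, in terms of falling factorials. -/
def admissible (n m : ℕ) : Set ℕ :=
  {q | q ≤ n + m ∧ ∀ l : ℕ, 1 ≤ l → l ≤ q / 2 →
    (descPochhammer ℝ (2 * l)).eval (q : ℝ) ≤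
      (descPochhammer ℝ (2 * l)).eval ((q : ℝ) - n) +
        (descPochhammer ℝ (2 * l)).eval ((q : ℝ) - m)}

lemma hNM_eq_sSup_admissible (n m : ℕ) : hNM n m = sSup (admissible n m) := by
  simp only [hNM, admissible, genChoose_le_add_iff, Int.cast_sub, Int.cast_natCast]

lemma bddAbove_admissible (n m : ℕ) : BddAbove (admissible n m) := ⟨n + m, fun _ h => h.1⟩

lemma half_mem_admissible (n m : ℕ) : n / 2 ∈ admissible n m := by
  refine ⟨by omega, fun l _ hl => ?_⟩
  have h1 := descPochhammer_two_mul_eval_int_nonneg (((n / 2 : ℕ) : ℤ) - m) l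
  simp only [Int.cast_sub, Int.cast_natCast] at h1
  refine le_add_of_le_of_nonneg ?_ h1
  have h2 : (2 : ℝ) * (n / 2 : ℕ) ≤ n := by exact_mod_cast Nat.mul_div_le n 2
  rw [← neg_sub (n : ℝ), descPochhammer_two_mul_eval_neg, descPochhammer_eval_eq_prod_range]
  refine Finset.prod_le_prod (fun i hi => ?_) fun i _ => ?_
  · have hi' : i ≤ n / 2 := by have := Finset.mem_range.1 hi; omega
    exact sub_nonneg.2 (by exact_mod_cast hi')
  · have := i.cast_nonneg (α := ℝ)
    linarith

lemma half_le_hNM (n m : ℕ) : n / 2 ≤ hNM n m :=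
  hNM_eq_sSup_admissible n m ▸ le_csSup (bddAbove_admissible n m) (half_mem_admissible n m)

lemma hNM_mem_admissible (n m : ℕ) : hNM n m ∈ admissible n m :=
  hNM_eq_sSup_admissible n m ▸ Nat.sSup_mem ⟨_, half_mem_admissible n m⟩ (bddAbove_admissible n m)

lemma lt_of_mem_admissible {n m q : ℕ} (hn : 2 ≤ n) (hm : 1 ≤ m) (hmn : m ≤ n)
    (hq : q ∈ admissible n m) : q < n := by
  by_contra! hnq
  have hk : 2 * (q / 2) ≤ q := Nat.mul_div_le q 2
  have h1 := hq.2 (q / 2) (by omega) le_rfl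
  have h2 := mul_descPochhammer_eval_sub_le hm (hmn.trans hnq) hk
  have h3 := descPochhammer_eval_natCast_pos hk
  have h4 : (descPochhammer ℝ (2 * (q / 2))).eval ((q : ℝ) - n) = 0 := by
    rw [← Nat.cast_sub hnq, descPochhammer_eval_eq_descFactorial,
      Nat.descFactorial_eq_zero_iff_lt.2 (by omega), Nat.cast_zero]
  have h5 : (0 : ℝ) < (2 * (q / 2) : ℕ) := by exact_mod_cast (by omega : 0 < 2 * (q / 2))
  rw [h4, zero_add] at h1
  nlinarith [mul_le_mul_of_nonneg_left h1 q.cast_nonneg, mul_pos h5 h3]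

lemma lt_of_mem_admissible_of_pow_lt {n m q l : ℕ} {ε : ℝ} (hε : 0 < ε) (hε1 : ε < 1)
    (hn : 2 ≤ n) (hm : 1 ≤ m) (hmn : m ≤ n) (hl : 1 ≤ l) (hln : 4 * l ≤ ε * n)
    (hpow : n * (1 - ε) ^ (2 * l) < 1) (hq : q ∈ admissible n m) :
    (q : ℝ) < (1 / 2 + ε) * n := by
  by_contra! hqe
  have hqn : q < n := lt_of_mem_admissible hn hm hmn hq
  have hqn' : (q : ℝ) < n := by exact_mod_cast hqn
  have hn' : (2 : ℝ) ≤ n := by exact_mod_cast hn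
  have hl' : (1 : ℝ) ≤ l := by exact_mod_cast hl
  have hk : 2 * l ≤ q := by
    have : ((2 * l : ℕ) : ℝ) ≤ q := by push_cast; nlinarith
    exact_mod_cast this
  have hratio : ∀ i < 2 * l, (n : ℝ) - q + i ≤ (1 - ε) * (q - i) := by
    intro i hi
    have hi' : (i : ℝ) ≤ 2 * l := by exact_mod_cast hi.le
    nlinarith [mul_pos hε hε]
  have hr : 0 ≤ 1 - ε := by linarith
  have h1 := hq.2 l hl (by omega)
  have h2 := descPochhammer_eval_sub_le_pow_mul hqn.le hratio
  have h3 := descPochhammer_eval_natCast_pos hk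
  set P := (descPochhammer ℝ (2 * l)).eval (q : ℝ)
  have hR : 0 ≤ (1 - ε) ^ (2 * l) := by positivity
  set R := (1 - ε) ^ (2 * l)
  rcases le_or_gt m q with hmq | hmq
  · have h4 := mul_descPochhammer_eval_sub_le hm hmq hk
    push_cast at h4
    have h5 : q * R < 1 := (mul_le_mul_of_nonneg_right hqn'.le hR).trans_lt hpow
    nlinarith [mul_le_mul_of_nonneg_left (h1.trans (add_le_add_left h2 _)) q.cast_nonneg]
  · have hmn' : (m : ℝ) ≤ n := by exact_mod_cast hmn
    have h4 := descPochhammer_eval_sub_le_pow_mul hmq.le fun i hi =>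
      (by linarith : (m : ℝ) - q + i ≤ n - q + i).trans (hratio i hi)
    nlinarith

lemma tendsto_mul_pow_floor {ε : ℝ} (hε : 0 < ε) (hε1 : ε < 1) :
    Tendsto (fun n : ℕ => (n : ℝ) * (1 - ε) ^ (2 * ⌊ε / 4 * n⌋₊)) atTop (𝓝 0) := by
  have hr : 0 ≤ 1 - ε := by linarith
  have hfloor : Tendsto (fun n : ℕ => ⌊ε / 4 * n⌋₊) atTop atTop :=
    tendsto_nat_floor_atTop.comp (tendsto_natCast_atTop_atTop.const_mul_atTop (by positivity))
  have hlim : Tendsto (fun l : ℕ => 4 / ε * ((l : ℝ) * (1 - ε) ^ l + (1 - ε) ^ l)) atTop (𝓝 0) := by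
    simpa using ((tendsto_self_mul_const_pow_of_lt_one hr (by linarith)).add
      (tendsto_pow_atTop_nhds_zero_of_lt_one hr (by linarith))).const_mul (4 / ε)
  refine squeeze_zero (fun n => by positivity) (fun n => ?_) (hlim.comp hfloor)
  set l := ⌊ε / 4 * (n : ℝ)⌋₊ with hl
  have h1 : (n : ℝ) ≤ 4 / ε * (l + 1) := by
    have := (Nat.lt_floor_add_one (ε / 4 * (n : ℝ))).le
    calc (n : ℝ) = 4 / ε * (ε / 4 * n) := by field_simp
      _ ≤ _ := by gcongr
  have h2 : (1 - ε) ^ (2 * l) ≤ (1 - ε) ^ l :=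
    pow_le_pow_of_le_one hr (by linarith) (by omega)
  calc (n : ℝ) * (1 - ε) ^ (2 * l) ≤ 4 / ε * (l + 1) * (1 - ε) ^ l := by gcongr
    _ = 4 / ε * (l * (1 - ε) ^ l + (1 - ε) ^ l) := by ring

lemma eventually_hNM_lt {m : ℕ → ℕ} (hm : ∀ n : ℕ, 1 ≤ n → 1 ≤ m n ∧ m n ≤ n) {ε : ℝ}
    (hε : 0 < ε) (hε1 : ε < 1) : ∀ᶠ n : ℕ in atTop, (hNM n (m n) : ℝ) < (1 / 2 + ε) * n := by
  have hlarge : ∀ᶠ n : ℕ in atTop, 4 / ε ≤ (n : ℝ) :=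
    tendsto_natCast_atTop_atTop.eventually_ge_atTop _
  filter_upwards [(tendsto_mul_pow_floor hε hε1).eventually_lt_const one_pos, hlarge,
    eventually_ge_atTop 2] with n hpow hn4 hn
  obtain ⟨hm1, hmn⟩ := hm n (by omega)
  refine lt_of_mem_admissible_of_pow_lt hε hε1 hn hm1 hmn (Nat.le_floor ?_) ?_ hpow
    (hNM_mem_admissible n (m n))
  · rw [div_le_iff₀ hε] at hn4
    push_cast
    linarith
  · have := Nat.floor_le (by positivity : 0 ≤ ε / 4 * (n : ℝ))
    linarith

/-- If 1 ≤ m(n) ≤ n for all n ≥ 1, then h(n, m(n))/n → 1/2 as n → ∞. -/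
theorem hNM_tendsto_half (m : ℕ → ℕ) (hm : ∀ n : ℕ, 1 ≤ n → 1 ≤ m n ∧ m n ≤ n) :
    Filter.Tendsto (fun n : ℕ => (hNM n (m n) : ℝ) / n) Filter.atTop (nhds (1 / 2)) := by
  refine tendsto_order.2 ⟨fun a ha => ?_, fun b hb => ?_⟩
  · have ha' : 0 < 1 - 2 * a := by linarith
    have hlarge : ∀ᶠ n : ℕ in atTop, 1 / (1 - 2 * a) < (n : ℝ) :=
      tendsto_natCast_atTop_atTop.eventually_gt_atTop _
    filter_upwards [hlarge, eventually_gt_atTop 0] with n hna hn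
    rw [div_lt_iff₀ ha'] at hna
    rw [lt_div_iff₀ (by exact_mod_cast hn)]
    have h : n ≤ 2 * hNM n (m n) + 1 := by have := half_le_hNM n (m n); omega
    have h' : (n : ℝ) ≤ 2 * hNM n (m n) + 1 := by exact_mod_cast h
    linarith
  · have hε : 0 < min (b - 1 / 2) (1 / 2) := lt_min (by linarith) (by norm_num)
    have hε1 : min (b - 1 / 2) (1 / 2) < 1 := (min_le_right _ _).trans_lt (by norm_num)
    filter_upwards [eventually_hNM_lt hm hε hε1, eventually_gt_atTop 0] with n h hn
    rw [div_lt_iff₀ (by exact_mod_cast hn)]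
    refine h.trans_le (mul_le_mul_of_nonneg_right ?_ n.cast_nonneg)
    linarith [min_le_left (b - 1 / 2) (1 / 2)]
end

section
/- Assume that for every positive integer s and every integer k the following four inequalities hold: (a) ∏_{j=1}^{2s} (1 + (2s+1)/(k−j)) ≤ 2 whenever k ≥ (2s+0.5)²/ln 2; (b) ∏_{j=1}^{2s+1} (1 + (2s+2)/(k−j)) ≤ 2 whenever k ≥ (2s+1.5)²/ln 2; (c) ∏_{j=0}^{2s−1} (1 + 2s/(k−j)) ≤ 2 whenever k ≥ 4s²/ln 2; (d) ∏_{j=2}^{2s+1} (1 + (2s+2)/(k−j)) ≤ 2 whenever k ≥ (2s+1)²/ln 2. Then for every integer n ≥ 2, h(n,n) ≥ ⌊ (n−1)/2 + √(⌊n/2⌋ · ln 2) ⌋. -/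
theorem genChoose_natCast_s11 (q m : ℕ) :
    genChoose (q : ℤ) m = (q.descFactorial m : ℚ) / (m.factorial : ℚ) := by
  unfold genChoose
  congr 1
  induction m with
  | zero => simp
  | succ m ih =>
    rw [Finset.prod_range_succ, ih, Nat.descFactorial_succ]
    rcases le_or_gt m q with h | h
    · push_cast [Nat.cast_sub h]
      ring
    · simp [Nat.descFactorial_of_lt h]

theorem genChoose_neg_natCast_of_even (p : ℕ) {m : ℕ} (hm : Even m) :
    genChoose (-(p : ℤ)) m = (p.ascFactorial m : ℚ) / (m.factorial : ℚ) := by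
  unfold genChoose
  congr 1
  have h : ∀ i ∈ Finset.range m, (((-(p : ℤ) : ℤ) : ℚ) - i) = (-1) * ((p : ℚ) + i) := by
    intro i _
    push_cast
    ring
  rw [Finset.prod_congr rfl h, Finset.prod_mul_distrib, Finset.prod_const, Finset.card_range,
    hm.neg_one_pow, one_mul, Nat.ascFactorial_eq_prod_range]
  push_cast
  rfl

theorem descFactorial_le_two_mul_ascFactorial_up {p q M : ℕ} (hq : q ≤ p + 2 * M)
    (hM : q.descFactorial M ≤ 2 * p.ascFactorial M) {m : ℕ} (hm : M ≤ m) :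
    q.descFactorial m ≤ 2 * p.ascFactorial m := by
  induction m, hm using Nat.le_induction with
  | base => exact hM
  | succ m hm ih =>
    rw [Nat.descFactorial_succ, Nat.ascFactorial_succ]
    calc (q - m) * q.descFactorial m ≤ (p + m) * (2 * p.ascFactorial m) :=
          Nat.mul_le_mul (by omega) ih
      _ = 2 * ((p + m) * p.ascFactorial m) := by ring

theorem descFactorial_le_two_mul_ascFactorial_down {p q M : ℕ} (hp : 0 < p)
    (hq : p + 2 * M ≤ q + 2)
    (hM : q.descFactorial M ≤ 2 * p.ascFactorial M) {m : ℕ} (hm : m ≤ M) :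
    q.descFactorial m ≤ 2 * p.ascFactorial m := by
  induction hm using Nat.decreasingInduction with
  | self => exact hM
  | of_succ m hm ih =>
    rw [Nat.descFactorial_succ, Nat.ascFactorial_succ] at ih
    refine Nat.le_of_mul_le_mul_left ?_ (show 0 < p + m by omega)
    calc (p + m) * q.descFactorial m ≤ (q - m) * q.descFactorial m :=
          Nat.mul_le_mul_right _ (by omega)
      _ ≤ 2 * ((p + m) * p.ascFactorial m) := ih
      _ = (p + m) * (2 * p.ascFactorial m) := by ring

theorem descFactorial_le_two_mul_ascFactorial_of_peak {p q M : ℕ} (hp : 0 < p)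
    (hq : q ≤ p + 2 * M) (hq' : p + 2 * M ≤ q + 2)
    (hM : q.descFactorial M ≤ 2 * p.ascFactorial M) (m : ℕ) :
    q.descFactorial m ≤ 2 * p.ascFactorial m := by
  rcases le_total M m with h | h
  · exact descFactorial_le_two_mul_ascFactorial_up hq hM h
  · exact descFactorial_le_two_mul_ascFactorial_down hp hq' hM h

/-- Reading `∏ (1 + c / (x - i)) ≤ 2` as a comparison of falling and rising factorials. -/
theorem descFactorial_le_two_mul_ascFactorial_of_prod_le {p q M : ℕ} (hp : 0 < p) (hMq : M ≤ q)
    {c x : ℝ} (hx : x + 1 = p + M) (hc : x + c = q)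
    (h : ∏ i ∈ Finset.range M, (1 + c / (x - (i : ℝ))) ≤ 2) :
    q.descFactorial M ≤ 2 * p.ascFactorial M := by
  have hpos : ∀ i ∈ Finset.range M, 0 < x - (i : ℝ) := by
    intro i hi
    have h1 : ((i + 1 : ℕ) : ℝ) ≤ M := by exact_mod_cast Finset.mem_range.mp hi
    have h2 : (1 : ℝ) ≤ p := by exact_mod_cast hp
    push_cast at h1
    linarith
  have hD : (q.descFactorial M : ℝ) = ∏ i ∈ Finset.range M, (x - (i : ℝ) + c) := by
    rw [Nat.descFactorial_eq_prod_range, Nat.cast_prod]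
    refine Finset.prod_congr rfl fun i hi => ?_
    have := Finset.mem_range.mp hi
    rw [Nat.cast_sub (by omega)]
    linarith
  have hA : (p.ascFactorial M : ℝ) = ∏ i ∈ Finset.range M, (x - (i : ℝ)) := by
    rw [Nat.ascFactorial_eq_prod_range, Nat.cast_prod, ← Finset.prod_range_reflect]
    refine Finset.prod_congr rfl fun i hi => ?_
    have := Finset.mem_range.mp hi
    have h3 : ((M - 1 - i : ℕ) : ℝ) = M - 1 - i := by
      rw [Nat.cast_sub (by omega), Nat.cast_sub (by omega)]
      simp
    rw [Nat.cast_add, h3]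
    linarith
  have hprod : ∏ i ∈ Finset.range M, (1 + c / (x - (i : ℝ))) =
      (q.descFactorial M : ℝ) / p.ascFactorial M := by
    rw [hD, hA, ← Finset.prod_div_distrib]
    refine Finset.prod_congr rfl fun i hi => ?_
    have := (hpos i hi).ne'
    field_simp
  have hA0 : (0 : ℝ) < p.ascFactorial M := hA ▸ Finset.prod_pos hpos
  rw [hprod, div_le_iff₀ hA0] at h
  exact_mod_cast h

theorem prod_Icc_eq_prod_range_add (f : ℕ → ℝ) (a M : ℕ) :
    ∏ j ∈ Finset.Icc a (a + M), f j = ∏ i ∈ Finset.range (M + 1), f (a + i) := by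
  rw [← Finset.Ico_add_one_right_eq_Icc, Finset.prod_Ico_eq_prod_range]
  congr 2
  omega

theorem sq_div_log_two_le {x y : ℝ} (hx : 0 < x) (h : x ≤ Real.sqrt (y * Real.log 2)) :
    x ^ 2 / Real.log 2 ≤ y := by
  rw [div_le_iff₀ (Real.log_pos (by norm_num))]
  exact (Real.le_sqrt' hx).mp h

theorem genChoose_diag_le {n q m : ℕ} (hqn : q ≤ n) (hm : Even m)
    (h : q.descFactorial m ≤ 2 * (n - q).ascFactorial m) :
    genChoose (q : ℤ) m ≤ genChoose ((q : ℤ) - n) m + genChoose ((q : ℤ) - n) m := by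
  have e : (q : ℤ) - n = -((n - q : ℕ) : ℤ) := by omega
  rw [e, genChoose_natCast_s11, genChoose_neg_natCast_of_even _ hm, ← add_div]
  refine div_le_div_of_nonneg_right ?_ (Nat.cast_nonneg _)
  rw [← two_mul]
  exact_mod_cast h

/-- Conditional sharper lower bound for h(n,n), assuming the four conjectural
product inequalities. -/
theorem hNM_diag_sharper_lower_bound
    (ha : ∀ s : ℕ, 1 ≤ s → ∀ k : ℤ,
      (2 * (s : ℝ) + 0.5) ^ 2 / Real.log 2 ≤ (k : ℝ) →
      ∏ j ∈ Finset.Icc 1 (2 * s), (1 + (2 * (s : ℝ) + 1) / ((k : ℝ) - (j : ℝ))) ≤ 2)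
    (hb : ∀ s : ℕ, 1 ≤ s → ∀ k : ℤ,
      (2 * (s : ℝ) + 1.5) ^ 2 / Real.log 2 ≤ (k : ℝ) →
      ∏ j ∈ Finset.Icc 1 (2 * s + 1), (1 + (2 * (s : ℝ) + 2) / ((k : ℝ) - (j : ℝ))) ≤ 2)
    (hc : ∀ s : ℕ, 1 ≤ s → ∀ k : ℤ,
      4 * (s : ℝ) ^ 2 / Real.log 2 ≤ (k : ℝ) →
      ∏ j ∈ Finset.range (2 * s), (1 + 2 * (s : ℝ) / ((k : ℝ) - (j : ℝ))) ≤ 2)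
    (hd : ∀ s : ℕ, 1 ≤ s → ∀ k : ℤ,
      (2 * (s : ℝ) + 1) ^ 2 / Real.log 2 ≤ (k : ℝ) →
      ∏ j ∈ Finset.Icc 2 (2 * s + 1), (1 + (2 * (s : ℝ) + 2) / ((k : ℝ) - (j : ℝ))) ≤ 2) :
    ∀ n : ℕ, 2 ≤ n →
      (⌊((n : ℝ) - 1) / 2 + Real.sqrt (((n / 2 : ℕ) : ℝ) * Real.log 2)⌋ : ℤ) ≤ (hNM n n : ℤ) := by
  intro n hn
  set r : ℝ := Real.sqrt (((n / 2 : ℕ) : ℝ) * Real.log 2) with hr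
  have hn' : (2 : ℝ) ≤ n := by exact_mod_cast hn
  have hr0 : 0 ≤ r := Real.sqrt_nonneg _
  obtain ⟨q, hq⟩ := Int.eq_ofNat_of_zero_le
    (Int.floor_nonneg.mpr (show 0 ≤ ((n : ℝ) - 1) / 2 + r by linarith))
  have hqr : (q : ℝ) ≤ ((n : ℝ) - 1) / 2 + r := by
    have := Int.floor_le (((n : ℝ) - 1) / 2 + r)
    rw [hq] at this
    exact_mod_cast this
  have hlog := Real.log_two_lt_d9
  have hrn : r < ((n : ℝ) + 1) / 2 := by
    rw [hr, Real.sqrt_lt' (by linarith)]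
    have h2 : ((n / 2 : ℕ) : ℝ) ≤ n / 2 := Nat.cast_div_le
    nlinarith [sq_nonneg ((n : ℝ) - 1), Real.log_pos (show (1 : ℝ) < 2 by norm_num)]
  have hqn : q < n := by
    have : (q : ℝ) < n := by linarith
    exact_mod_cast this
  rw [hq]
  refine Int.ofNat_le.mpr (le_csSup ⟨n + n, fun x hx => hx.1⟩ ⟨by omega, fun l _ _ => ?_⟩)
  refine genChoose_diag_le hqn.le (even_two_mul l) ?_
  obtain ⟨p, rfl⟩ : ∃ p, n = q + p := ⟨n - q, by omega⟩
  rw [Nat.add_sub_cancel_left]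
  have hp : 0 < p := by omega
  rcases Nat.lt_or_ge q (p + 2) with hd2 | hd2
  · rcases Nat.lt_or_ge p q with hd1 | hd1
    · refine descFactorial_le_two_mul_ascFactorial_of_peak (M := 1) hp (by omega) (by omega) ?_ _
      simp [Nat.ascFactorial_succ]
      omega
    · exact descFactorial_le_two_mul_ascFactorial_up (M := 0) (by omega) (by simp) (Nat.zero_le _)
  obtain ⟨d, rfl⟩ : ∃ d, q = p + d := ⟨q - p, by omega⟩
  have hcases : (∃ s, 1 ≤ s ∧ d = 4 * s) ∨ d = 2 ∨ (∃ s, 1 ≤ s ∧ d = 4 * s + 2) ∨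
      (∃ s, 1 ≤ s ∧ d + 1 = 4 * s) ∨ (∃ s, 1 ≤ s ∧ d = 4 * s + 1) := by
    have h4 := Nat.div_add_mod d 4
    have : d % 4 < 4 := Nat.mod_lt _ (by norm_num)
    interval_cases h : d % 4
    · exact .inl ⟨d / 4, by omega, by omega⟩
    · exact .inr (.inr (.inr (.inr ⟨d / 4, by omega, by omega⟩)))
    · by_cases d = 2
      · exact .inr (.inl ‹_›)
      · exact .inr (.inr (.inl ⟨d / 4, by omega, by omega⟩))
    · exact .inr (.inr (.inr (.inl ⟨d / 4 + 1, by omega, by omega⟩)))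
  rcases hcases with ⟨s, hs, rfl⟩ | rfl | ⟨s, hs, rfl⟩ | ⟨s, hs, hds⟩ | ⟨s, hs, rfl⟩
  · rw [show (p + 4 * s + p) / 2 = p + 2 * s by omega] at hr
    push_cast at hr hqr
    have h := ha s hs ((p + 2 * s : ℕ) : ℤ) (by
      push_cast
      refine sq_div_log_two_le (by positivity) ?_
      rw [← hr]
      linarith)
    rw [show 2 * s = 1 + (2 * s - 1) by omega, prod_Icc_eq_prod_range_add,
      show 2 * s - 1 + 1 = 2 * s by omega] at h
    refine descFactorial_le_two_mul_ascFactorial_of_peak (M := 2 * s) hp (by omega) (by omega) ?_ _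
    refine descFactorial_le_two_mul_ascFactorial_of_prod_le (c := 2 * s + 1)
      (x := p + 2 * s - 1) hp (by omega) (by push_cast; ring) (by push_cast; ring) ?_
    convert h using 4 with i
    push_cast [show 1 + (2 * s - 1) = 2 * s by omega]
    ring
  · rw [show (p + 2 + p) / 2 = p + 1 by omega] at hr
    push_cast at hr hqr
    have h : (1.5 : ℝ) ^ 2 ≤ (p + 1) * Real.log 2 :=
      (Real.le_sqrt' (by norm_num)).mp (by rw [← hr]; linarith)
    have hp2 : 2 ≤ p := by
      by_contra hlt
      obtain rfl : p = 1 := by omega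
      norm_num at h
      linarith
    refine descFactorial_le_two_mul_ascFactorial_of_peak (M := 1) hp (by omega) (by omega) ?_ _
    simp [Nat.ascFactorial_succ]
    omega
  · rw [show (p + (4 * s + 2) + p) / 2 = p + 2 * s + 1 by omega] at hr
    push_cast at hr hqr
    have h := hb s hs ((p + 2 * s + 1 : ℕ) : ℤ) (by
      push_cast
      refine sq_div_log_two_le (by positivity) ?_
      rw [← hr]
      linarith)
    rw [show 2 * s + 1 = 1 + 2 * s by omega, prod_Icc_eq_prod_range_add] at h
    refine descFactorial_le_two_mul_ascFactorial_of_peak (M := 2 * s + 1) hp (by omega) (by omega)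
      ?_ _
    refine descFactorial_le_two_mul_ascFactorial_of_prod_le (c := 2 * s + 2)
      (x := p + 2 * s) hp (by omega) (by push_cast; ring) (by push_cast; ring) ?_
    convert h using 4 with i
    push_cast
    ring
  · rw [show (p + d + p) / 2 = p + 2 * s - 1 by omega] at hr
    have hdr : (d : ℝ) + 1 = 4 * s := by exact_mod_cast hds
    push_cast [show 1 ≤ p + 2 * s by omega] at hr hqr
    have h := hc s hs ((p + 2 * s - 1 : ℕ) : ℤ) (by
      push_cast [show 1 ≤ p + 2 * s by omega]
      rw [show 4 * (s : ℝ) ^ 2 = (2 * s) ^ 2 by ring]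
      refine sq_div_log_two_le (by positivity) ?_
      rw [← hr]
      linarith)
    refine descFactorial_le_two_mul_ascFactorial_of_peak (M := 2 * s) hp (by omega) (by omega) ?_ _
    refine descFactorial_le_two_mul_ascFactorial_of_prod_le (c := 2 * s)
      (x := p + 2 * s - 1) hp (by omega) (by push_cast; ring) (by push_cast; linarith) ?_
    convert h using 5 with i
    push_cast [show 1 ≤ p + 2 * s by omega]
    ring
  · rw [show (p + (4 * s + 1) + p) / 2 = p + 2 * s by omega] at hr
    push_cast at hr hqr
    have h := hd s hs ((p + 2 * s + 1 : ℕ) : ℤ) (by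
      push_cast
      refine (sq_div_log_two_le (y := p + 2 * s) (by positivity) ?_).trans (by linarith)
      rw [← hr]
      linarith)
    rw [show 2 * s + 1 = 2 + (2 * s - 1) by omega, prod_Icc_eq_prod_range_add,
      show 2 * s - 1 + 1 = 2 * s by omega] at h
    have hM : (p + (4 * s + 1)).descFactorial (2 * s) ≤ 2 * p.ascFactorial (2 * s) := by
      refine descFactorial_le_two_mul_ascFactorial_of_prod_le (c := 2 * s + 2)
        (x := p + 2 * s - 1) hp (by omega) (by push_cast; ring) (by push_cast; ring) ?_
      convert h using 4 with i
      push_cast [show 2 + (2 * s - 1) = 2 * s + 1 by omega]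
      ring
    rcases le_or_gt l s with hl | hl
    · exact descFactorial_le_two_mul_ascFactorial_down hp (by omega) hM (by omega)
    · refine descFactorial_le_two_mul_ascFactorial_up (M := 2 * s + 2) (by omega) ?_ (by omega)
      rw [Nat.descFactorial_succ, Nat.descFactorial_succ, Nat.ascFactorial_succ,
        Nat.ascFactorial_succ, show p + (4 * s + 1) - (2 * s + 1) = p + 2 * s by omega,
        show p + (4 * s + 1) - 2 * s = p + (2 * s + 1) by omega]
      calc _ = (p + 2 * s) * (p + (2 * s + 1)) * (p + (4 * s + 1)).descFactorial (2 * s) := by ring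
        _ ≤ (p + 2 * s) * (p + (2 * s + 1)) * (2 * p.ascFactorial (2 * s)) :=
          Nat.mul_le_mul_left _ hM
        _ = _ := by ring
end

section
/- For all integers s ≥ 1 and k with k ≥ 4s²/ln 2, we have 2·C(k, 2s) ≥ C(k + 2s − 1, 2s). -/
/-- The rising factorial exceeds the falling factorial by at most an exponential factor. -/
lemma ascFactorial_le_exp_mul_descFactorial (k m : ℕ) (D : ℝ) (hD : 0 < D)
    (hm : D + m ≤ k + 1) :
    (k.ascFactorial m : ℝ) ≤ Real.exp (m * (m - 1) / D) * k.descFactorial m := by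
  induction m with
  | zero => simp
  | succ m ih =>
    push_cast at hm
    have hmk : m ≤ k := by
      have : (m : ℝ) ≤ k := by linarith
      exact_mod_cast this
    have hstep : (k : ℝ) + m ≤ Real.exp (2 * m / D) * (k - m) := by
      have hDk : D ≤ k - m := by linarith
      calc (k : ℝ) + m = k - m + 2 * m / D * D := by field_simp; ring
        _ ≤ k - m + 2 * m / D * (k - m) := by gcongr
        _ = (2 * m / D + 1) * (k - m) := by ring
        _ ≤ _ := mul_le_mul_of_nonneg_right (Real.add_one_le_exp _) (by linarith)
    have hexp : Real.exp (((m + 1 : ℕ) : ℝ) * (((m + 1 : ℕ) : ℝ) - 1) / D)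
        = Real.exp (2 * m / D) * Real.exp (m * (m - 1) / D) := by
      rw [← Real.exp_add]
      congr 1
      push_cast
      ring
    rw [Nat.ascFactorial_succ, Nat.descFactorial_succ, hexp]
    push_cast [Nat.cast_sub hmk]
    calc ((k : ℝ) + m) * k.ascFactorial m
        ≤ (Real.exp (2 * m / D) * (k - m)) *
            (Real.exp (m * (m - 1) / D) * k.descFactorial m) :=
          mul_le_mul hstep (ih (by linarith)) (by positivity) (le_trans (by positivity) hstep)
      _ = _ := by ring

/-- For s ≥ 1 and k ≥ 4s²/ln 2, we have 2·C(k, 2s) ≥ C(k + 2s − 1, 2s). -/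
theorem choose_ineq_a (s k : ℕ) (hs : 1 ≤ s)
    (hk : 4 * (s : ℝ) ^ 2 / Real.log 2 ≤ (k : ℝ)) :
    Nat.choose (k + 2 * s - 1) (2 * s) ≤ 2 * Nat.choose k (2 * s) := by
  have hlog : 0 < Real.log 2 := Real.log_pos one_lt_two
  have hlog1 : Real.log 2 ≤ 1 := by linarith [Real.log_two_lt_d9]
  have hs' : (1 : ℝ) ≤ s := by exact_mod_cast hs
  rw [div_le_iff₀ hlog] at hk
  have hD : 0 < (k : ℝ) + 1 - 2 * s := by nlinarith
  have hexp : Real.exp (((2 * s : ℕ) : ℝ) * (((2 * s : ℕ) : ℝ) - 1) / (k + 1 - 2 * s)) ≤ 2 := by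
    rw [← Real.le_log_iff_exp_le two_pos, div_le_iff₀ hD]
    push_cast
    nlinarith
  have key : k.ascFactorial (2 * s) ≤ 2 * k.descFactorial (2 * s) := by
    have h := (ascFactorial_le_exp_mul_descFactorial k (2 * s) _ hD (by push_cast; linarith)).trans
      (mul_le_mul_of_nonneg_right hexp (Nat.cast_nonneg _))
    exact_mod_cast h
  rw [Nat.ascFactorial_eq_factorial_mul_choose', Nat.descFactorial_eq_factorial_mul_choose,
    mul_left_comm] at key
  exact Nat.le_of_mul_le_mul_left key (Nat.factorial_pos _)
end

section
/- For all integers s ≥ 1 and k with k ≥ (2s+1)²/ln 2, we have 2·C(k − 1, 2s) ≥ C(k + 2s, 2s). -/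
/-- The ratio `C(k + m, m) / C(k - 1, m) = ∏ (k + i) / (k - i)` is at most
`exp (∑ 2 i / (k - n))` for `m ≤ n < k`. -/
lemma choose_add_le_exp_mul_choose_pred {k n : ℕ} (hn : n < k) {m : ℕ} (hm : m ≤ n) :
    ((k + m).choose m : ℝ) ≤
      Real.exp ((m : ℝ) * (m + 1) / ((k : ℝ) - n)) * ((k - 1).choose m : ℝ) := by
  induction m with
  | zero => simp
  | succ m ih =>
    specialize ih (by omega)
    have hnk : (n : ℝ) < k := by exact_mod_cast hn
    have hmn : (m : ℝ) + 1 ≤ n := by exact_mod_cast hm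
    have hd : (0 : ℝ) < (k : ℝ) - n := by linarith
    have hnum : ((k : ℝ) + m + 1) * (k + m).choose m
        = ((k + (m + 1)).choose (m + 1) : ℝ) * (m + 1) := by
      exact_mod_cast Nat.add_one_mul_choose_eq (k + m) m
    have hden : ((k - 1).choose (m + 1) : ℝ) * (m + 1)
        = ((k - 1).choose m : ℝ) * ((k : ℝ) - 1 - m) := by
      have h := Nat.choose_succ_right_eq (k - 1) m
      have hc : ((k - 1 - m : ℕ) : ℝ) = (k : ℝ) - 1 - m := by
        rw [Nat.cast_sub (by omega), Nat.cast_sub (by omega)]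
        simp
      rw [← hc]
      exact_mod_cast h
    have hfactor : (k : ℝ) + m + 1 ≤
        Real.exp (2 * ((m : ℝ) + 1) / ((k : ℝ) - n)) * ((k : ℝ) - 1 - m) := by
      have hexp := Real.add_one_le_exp (2 * ((m : ℝ) + 1) / ((k : ℝ) - n))
      have hcancel : 2 * ((m : ℝ) + 1) / ((k : ℝ) - n) * ((k : ℝ) - n) = 2 * (m + 1) :=
        div_mul_cancel₀ _ hd.ne'
      have hpos : 0 ≤ 2 * ((m : ℝ) + 1) / ((k : ℝ) - n) := by positivity
      nlinarith [mul_le_mul_of_nonneg_right hexp (by linarith : (0 : ℝ) ≤ (k : ℝ) - 1 - m),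
        mul_le_mul_of_nonneg_left (by linarith : (k : ℝ) - n ≤ (k : ℝ) - 1 - m) hpos]
    have hsplit : Real.exp (((m + 1 : ℕ) : ℝ) * ((m + 1 : ℕ) + 1) / ((k : ℝ) - n))
        = Real.exp (2 * ((m : ℝ) + 1) / ((k : ℝ) - n))
          * Real.exp ((m : ℝ) * (m + 1) / ((k : ℝ) - n)) := by
      rw [← Real.exp_add]
      congr 1
      push_cast
      ring
    refine le_of_mul_le_mul_right ?_ (by positivity : (0 : ℝ) < (m : ℝ) + 1)
    rw [← hnum, mul_assoc, hden, hsplit]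
    calc ((k : ℝ) + m + 1) * (k + m).choose m
        ≤ (Real.exp (2 * ((m : ℝ) + 1) / ((k : ℝ) - n)) * ((k : ℝ) - 1 - m)) *
          (Real.exp ((m : ℝ) * (m + 1) / ((k : ℝ) - n)) * ((k - 1).choose m : ℝ)) :=
          mul_le_mul hfactor ih (by positivity) (le_trans (by positivity) hfactor)
      _ = _ := by ring

/-- For s ≥ 1 and k ≥ (2s+1)²/ln 2, we have 2·C(k − 1, 2s) ≥ C(k + 2s, 2s). -/
theorem choose_ineq_b (s k : ℕ) (hs : 1 ≤ s)
    (hk : (2 * (s : ℝ) + 1) ^ 2 / Real.log 2 ≤ (k : ℝ)) :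
    Nat.choose (k + 2 * s) (2 * s) ≤ 2 * Nat.choose (k - 1) (2 * s) := by
  have hlog : 0 < Real.log 2 := Real.log_pos one_lt_two
  have hlog1 : Real.log 2 < 1 := Real.log_two_lt_d9.trans (by norm_num)
  have hs0 : (1 : ℝ) ≤ s := by exact_mod_cast hs
  rw [div_le_iff₀ hlog] at hk
  have hlt : 2 * (s : ℝ) < k := by nlinarith
  have h := choose_add_le_exp_mul_choose_pred (n := 2 * s) (by exact_mod_cast hlt) le_rfl
  have hexp : Real.exp (((2 * s : ℕ) : ℝ) * ((2 * s : ℕ) + 1) / ((k : ℝ) - (2 * s : ℕ))) ≤ 2 := by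
    rw [← Real.le_log_iff_exp_le two_pos]
    push_cast
    rw [div_le_iff₀ (by linarith)]
    nlinarith
  have hle := h.trans (mul_le_mul_of_nonneg_right hexp (Nat.cast_nonneg _))
  exact_mod_cast hle
end

section
/- For all integers s ≥ 1 and k with k ≥ (2s + 0.5)²/ln 2, we have 2·C(k, 2s) ≥ C(k + 2s, 2s). -/
/-- The ratio of `C(k + m, m)` to `C(k, m)` is at most `exp (m² / D)` for `0 < D ≤ k + 1 - m`. -/
lemma choose_add_le_choose_mul_exp (k m : ℕ) (D : ℝ) (hD : 0 < D) (h : D + m ≤ k + 1) :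
    ((k + m).choose m : ℝ) ≤ k.choose m * Real.exp ((m : ℝ) ^ 2 / D) := by
  induction m with
  | zero => simp
  | succ m ih =>
    push_cast at h ⊢
    have ih := ih (by linarith)
    have hmk : m ≤ k := by
      have : (m : ℝ) ≤ k := by linarith
      exact_mod_cast this
    have h₁ : ((k : ℝ) + m + 1) * (k + m).choose m = (k + m + 1).choose (m + 1) * (m + 1) := by
      exact_mod_cast Nat.add_one_mul_choose_eq (k + m) m
    have h₂ : (k.choose (m + 1) : ℝ) * (m + 1) = k.choose m * (k - m) := by
      have := Nat.choose_succ_right_eq k m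
      rw [← Nat.cast_sub hmk]
      exact_mod_cast this
    have hstep : (k : ℝ) + m + 1 ≤ (k - m) * Real.exp ((2 * m + 1) / D) := by
      have h_exp := Real.add_one_le_exp ((2 * (m : ℝ) + 1) / D)
      have h_mul : 2 * (m : ℝ) + 1 ≤ (k - m) * ((2 * m + 1) / D) := by
        rw [mul_div_assoc', le_div_iff₀ hD, mul_comm]
        gcongr
        linarith
      have := mul_le_mul_of_nonneg_left h_exp (show (0 : ℝ) ≤ k - m by linarith)
      linarith
    have hexp : Real.exp (((m : ℝ) + 1) ^ 2 / D) =
        Real.exp ((m : ℝ) ^ 2 / D) * Real.exp ((2 * m + 1) / D) := by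
      rw [← Real.exp_add]
      congr 1
      ring
    refine le_of_mul_le_mul_right ?_ (show (0 : ℝ) < m + 1 by positivity)
    calc ((k + (m + 1)).choose (m + 1) : ℝ) * (m + 1)
        = (k + m + 1) * (k + m).choose m := h₁.symm
      _ ≤ ((k - m) * Real.exp ((2 * m + 1) / D)) *
            (k.choose m * Real.exp ((m : ℝ) ^ 2 / D)) :=
          mul_le_mul hstep ih (by positivity) (le_trans (by positivity) hstep)
      _ = k.choose (m + 1) * Real.exp (((m : ℝ) + 1) ^ 2 / D) * (m + 1) := by
          rw [hexp]
          linear_combination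
            (-(Real.exp ((m : ℝ) ^ 2 / D) * Real.exp ((2 * m + 1) / D))) * h₂

/-- For s ≥ 1 and k ≥ (2s+0.5)²/ln 2, we have 2·C(k, 2s) ≥ C(k + 2s, 2s). -/
theorem choose_ineq_c (s k : ℕ) (hs : 1 ≤ s)
    (hk : (2 * (s : ℝ) + 0.5) ^ 2 / Real.log 2 ≤ (k : ℝ)) :
    Nat.choose (k + 2 * s) (2 * s) ≤ 2 * Nat.choose k (2 * s) := by
  have hlog : 0 < Real.log 2 := Real.log_pos one_lt_two
  have hlog_lt : Real.log 2 < 1 := Real.log_two_lt_d9.trans (by norm_num)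
  have hs' : (1 : ℝ) ≤ s := by exact_mod_cast hs
  rw [div_le_iff₀ hlog] at hk
  have hkey : (2 * (s : ℝ)) ^ 2 ≤ (k + 1 - 2 * s) * Real.log 2 := by
    nlinarith [mul_le_mul_of_nonneg_left hlog_lt.le (show (0 : ℝ) ≤ s by linarith)]
  have hD : (0 : ℝ) < k + 1 - 2 * s :=
    pos_of_mul_pos_left (lt_of_lt_of_le (by positivity) hkey) hlog.le
  have hmain := choose_add_le_choose_mul_exp k (2 * s) (k + 1 - 2 * s) hD
    (by push_cast; linarith)
  have hexp : Real.exp (((2 * s : ℕ) : ℝ) ^ 2 / (k + 1 - 2 * s)) ≤ 2 := by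
    rw [← Real.le_log_iff_exp_le two_pos, div_le_iff₀ hD]
    push_cast
    linarith
  have : ((k + 2 * s).choose (2 * s) : ℝ) ≤ 2 * k.choose (2 * s) := by
    rw [mul_comm (2 : ℝ)]
    exact hmain.trans (mul_le_mul_of_nonneg_left hexp (Nat.cast_nonneg _))
  exact_mod_cast this
end

section
/- For all integers s ≥ 1 and k with k ≥ (2s + 1.5)²/ln 2, we have 2·C(k − 1, 2s) ≥ C(k + 2s + 1, 2s). -/
theorem ascFactorial_le_descFactorial_mul_exp {n k : ℕ} (hnk : n < k) {m : ℕ} (hm : m ≤ n) :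
    ((k + 2).ascFactorial m : ℝ) ≤
      (k - 1).descFactorial m * Real.exp (m * (m + 2) / ((k : ℝ) - n)) := by
  have ht : (0 : ℝ) < (k : ℝ) - n := sub_pos.2 (by exact_mod_cast hnk)
  induction m with
  | zero => simp
  | succ m ih =>
    have hmn : (m : ℝ) + 1 ≤ n := by exact_mod_cast hm
    have hsub : ((k - 1 - m : ℕ) : ℝ) = (k : ℝ) - 1 - m := by
      rw [Nat.cast_sub (by omega), Nat.cast_sub (by omega)]
      simp
    have hstep : (k : ℝ) + 2 + m ≤
        ((k : ℝ) - 1 - m) * Real.exp ((2 * m + 3) / ((k : ℝ) - n)) := by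
      have hexp := Real.add_one_le_exp ((2 * (m : ℝ) + 3) / ((k : ℝ) - n))
      have hdiv : 2 * (m : ℝ) + 3 ≤
          ((k : ℝ) - 1 - m) * ((2 * m + 3) / ((k : ℝ) - n)) := by
        rw [← mul_div_assoc, le_div_iff₀ ht]
        nlinarith
      calc (k : ℝ) + 2 + m
          ≤ ((k : ℝ) - 1 - m) * ((2 * m + 3) / ((k : ℝ) - n) + 1) := by linarith
        _ ≤ _ := mul_le_mul_of_nonneg_left hexp (by linarith)
    have hsplit : ((m + 1 : ℕ) : ℝ) * ((m + 1 : ℕ) + 2) / ((k : ℝ) - n) =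
        (2 * m + 3) / ((k : ℝ) - n) + m * (m + 2) / ((k : ℝ) - n) := by
      push_cast
      ring
    rw [Nat.ascFactorial_succ, Nat.descFactorial_succ, hsplit, Real.exp_add]
    push_cast
    rw [hsub]
    calc _ ≤ _ := mul_le_mul hstep (ih (by omega)) (by positivity)
          (mul_nonneg (by linarith) (Real.exp_nonneg _))
      _ = _ := by ring

/-- For s ≥ 1 and k ≥ (2s+1.5)²/ln 2, we have 2·C(k − 1, 2s) ≥ C(k + 2s + 1, 2s). -/
theorem choose_ineq_d (s k : ℕ) (hs : 1 ≤ s)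
    (hk : (2 * (s : ℝ) + 1.5) ^ 2 / Real.log 2 ≤ (k : ℝ)) :
    Nat.choose (k + 2 * s + 1) (2 * s) ≤ 2 * Nat.choose (k - 1) (2 * s) := by
  have hlog : 0 < Real.log 2 := Real.log_pos one_lt_two
  have hlog1 : Real.log 2 < 1 := Real.log_two_lt_d9.trans (by norm_num)
  have hs' : (1 : ℝ) ≤ s := by exact_mod_cast hs
  rw [div_le_iff₀ hlog] at hk
  have hlt : 2 * (s : ℝ) < k := by nlinarith [(Nat.cast_nonneg k : (0 : ℝ) ≤ k)]
  have hnk : 2 * s < k := by exact_mod_cast hlt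
  have key := ascFactorial_le_descFactorial_mul_exp hnk le_rfl
  have hexp : Real.exp (((2 * s : ℕ) : ℝ) * ((2 * s : ℕ) + 2) / ((k : ℝ) - (2 * s : ℕ))) ≤ 2 := by
    rw [← Real.le_log_iff_exp_le two_pos]
    push_cast
    rw [div_le_iff₀ (sub_pos.2 hlt)]
    nlinarith
  have hnat : (k + 2).ascFactorial (2 * s) ≤ (k - 1).descFactorial (2 * s) * 2 := by
    exact_mod_cast key.trans (mul_le_mul_of_nonneg_left hexp (Nat.cast_nonneg _))
  rw [Nat.ascFactorial_eq_factorial_mul_choose, Nat.descFactorial_eq_factorial_mul_choose,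
    mul_assoc] at hnat
  have := Nat.le_of_mul_le_mul_left hnat (Nat.factorial_pos _)
  rwa [mul_comm _ 2, add_right_comm] at this
end

section
/- For all integers s ≥ 1 and k with (2s − 0.5)²/ln 2 ≤ k < (2s + 0.5)²/ln 2, we have 2·C(k, 2s+2) < C(k + 2s + 1, 2s + 2). -/
lemma exp_two_mul_div_mul_sub_le (k j : ℕ) (hk : 0 < k) :
    Real.exp (2 * j / k) * ((k - j : ℕ) : ℝ) ≤ k + j := by
  rcases le_or_gt k j with h | h
  · rw [Nat.sub_eq_zero_of_le h]
    simp only [Nat.cast_zero, mul_zero]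
    positivity
  · have hk' : (0 : ℝ) < k := by exact_mod_cast hk
    have hd : (0 : ℝ) < k - j := sub_pos.2 (by exact_mod_cast h)
    have hlog := Real.le_log_one_add_of_nonneg (x := 2 * (j : ℝ) / (k - j)) (by positivity)
    have hl : 2 * (2 * (j : ℝ) / (k - j)) / (2 * (j : ℝ) / (k - j) + 2) = 2 * j / k := by
      have : 2 * (j : ℝ) / (k - j) + 2 = 2 * k / (k - j) := by field_simp; ring
      rw [this]
      field_simp
    have hr : 1 + 2 * (j : ℝ) / (k - j) = (k + j) / (k - j) := by field_simp; ring
    rw [hl, hr, Real.le_log_iff_exp_le (by positivity), le_div_iff₀ hd] at hlog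
    rwa [Nat.cast_sub h.le]

lemma exp_mul_descFactorial_le (k n : ℕ) (hk : 0 < k) :
    Real.exp (n * (n + 1) / k) * (k.descFactorial (n + 1) : ℝ) ≤
      ((k + n).descFactorial (n + 1) : ℝ) := by
  induction n with
  | zero => simp
  | succ n ih =>
    have hstep := exp_two_mul_div_mul_sub_le k (n + 1) hk
    have he : Real.exp (((n + 1 : ℕ) : ℝ) * (((n + 1 : ℕ) : ℝ) + 1) / k) =
        Real.exp (2 * ((n + 1 : ℕ) : ℝ) / k) * Real.exp (n * (n + 1) / k) := by
      rw [← Real.exp_add]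
      congr 1
      push_cast
      ring
    rw [he, Nat.descFactorial_succ k (n + 1), ← add_assoc k n 1,
      Nat.succ_descFactorial_succ (k + n) (n + 1), Nat.cast_mul, Nat.cast_mul]
    calc _ = (Real.exp (2 * ((n + 1 : ℕ) : ℝ) / k) * ((k - (n + 1) : ℕ) : ℝ)) *
          (Real.exp (n * (n + 1) / k) * (k.descFactorial (n + 1) : ℝ)) := by ring
      _ ≤ (k + (n + 1 : ℕ)) * ((k + n).descFactorial (n + 1) : ℝ) := by gcongr
      _ = _ := by push_cast; ring

/-- For s ≥ 1 and (2s−0.5)²/ln 2 ≤ k < (2s+0.5)²/ln 2, we have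
2·C(k, 2s+2) < C(k + 2s + 1, 2s + 2). -/
theorem choose_strict_ineq_a (s k : ℕ) (hs : 1 ≤ s)
    (hk1 : (2 * (s : ℝ) - 0.5) ^ 2 / Real.log 2 ≤ (k : ℝ))
    (hk2 : (k : ℝ) < (2 * (s : ℝ) + 0.5) ^ 2 / Real.log 2) :
    2 * Nat.choose k (2 * s + 2) < Nat.choose (k + 2 * s + 1) (2 * s + 2) := by
  have hlog : 0 < Real.log 2 := Real.log_pos one_lt_two
  have hs' : (1 : ℝ) ≤ s := by exact_mod_cast hs
  have hkR : (0 : ℝ) < k :=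
    lt_of_lt_of_le (div_pos (pow_pos (by linarith) 2) hlog) hk1
  have hk : 0 < k := by exact_mod_cast hkR
  have hexp : 2 < Real.exp (((2 * s + 1 : ℕ) : ℝ) * (((2 * s + 1 : ℕ) : ℝ) + 1) / k) := by
    rw [← Real.log_lt_iff_lt_exp two_pos, lt_div_iff₀ hkR]
    rw [lt_div_iff₀ hlog] at hk2
    push_cast
    nlinarith
  have hmain := exp_mul_descFactorial_le k (2 * s + 1) hk
  rw [← add_assoc k (2 * s) 1] at hmain
  have hdesc : 2 * k.descFactorial (2 * s + 2) < (k + 2 * s + 1).descFactorial (2 * s + 2) := by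
    rcases Nat.eq_zero_or_pos (k.descFactorial (2 * s + 2)) with h | h
    · rw [h, mul_zero]
      exact Nat.descFactorial_pos.2 (by omega)
    · have h' : (0 : ℝ) < k.descFactorial (2 * s + 2) := by exact_mod_cast h
      exact_mod_cast (mul_lt_mul_of_pos_right hexp h').trans_le hmain
  rw [Nat.descFactorial_eq_factorial_mul_choose, Nat.descFactorial_eq_factorial_mul_choose,
    mul_left_comm] at hdesc
  exact Nat.lt_of_mul_lt_mul_left hdesc
end

section
/- For all integers s ≥ 1 and k with (2s − 1.5)²/ln 2 ≤ k < (2s − 0.5)²/ln 2, we have 2·C(k − 1, 2s) < C(k + 2s, 2s). -/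
theorem one_sub_mul_exp_two_mul_le_one_add {x : ℝ} (hx : 0 ≤ x) :
    (1 - x) * Real.exp (2 * x) ≤ 1 + x := by
  rcases le_or_gt 1 x with h | h
  · have := mul_nonneg (sub_nonneg.2 h) (Real.exp_pos (2 * x)).le
    linarith
  · have h1 : 0 < 1 - x := sub_pos.2 h
    have hlog := Real.le_log_one_add_of_nonneg (x := 2 * x / (1 - x)) (by positivity)
    have hleft : 2 * (2 * x / (1 - x)) / (2 * x / (1 - x) + 2) = 2 * x := by
      have : 2 * x / (1 - x) + 2 = 2 / (1 - x) := by field_simp; ring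
      rw [this]
      field_simp
    have hright : 1 + 2 * x / (1 - x) = (1 + x) / (1 - x) := by field_simp; ring
    rw [hleft, hright, Real.le_log_iff_exp_le (by positivity), le_div_iff₀ h1] at hlog
    linarith

theorem exp_mul_choose_pred_le_choose_add {k : ℕ} (hk : 0 < k) (n : ℕ) :
    Real.exp (n * (n + 1) / k) * ((k - 1).choose n : ℝ) ≤ ((k + n).choose n : ℝ) := by
  induction n with
  | zero => simp
  | succ n ih =>
    have hk0 : (0 : ℝ) < k := by exact_mod_cast hk
    rcases Nat.lt_or_ge (k - 1) (n + 1) with h | h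
    · simp [Nat.choose_eq_zero_of_lt h]
    · have hpred : ((k - 1).choose (n + 1) : ℝ) * (n + 1) =
          ((k - 1).choose n : ℝ) * (k - (n + 1)) := by
        have := Nat.choose_succ_right_eq (k - 1) n
        have hc : ((k - 1 - n : ℕ) : ℝ) = k - (n + 1) := by
          rw [Nat.sub_sub, Nat.cast_sub (by omega)]
          push_cast
          ring
        rw [← hc]
        exact_mod_cast this
      have hadd : ((k + (n + 1)).choose (n + 1) : ℝ) * (n + 1) =
          (k + (n + 1)) * ((k + n).choose n : ℝ) := by
        exact_mod_cast (Nat.add_one_mul_choose_eq (k + n) n).symm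
      have hstep : (k - (n + 1)) * Real.exp (2 * ((n + 1) / k)) ≤ (k + (n + 1) : ℝ) := by
        have := mul_le_mul_of_nonneg_left
          (one_sub_mul_exp_two_mul_le_one_add (x := ((n : ℝ) + 1) / k) (by positivity)) hk0.le
        rw [← mul_assoc, mul_sub, mul_add, mul_div_cancel₀ _ hk0.ne', mul_one] at this
        exact this
      have hexp : Real.exp (((n + 1 : ℕ) : ℝ) * (((n + 1 : ℕ) : ℝ) + 1) / k) =
          Real.exp (n * (n + 1) / k) * Real.exp (2 * ((n + 1) / k)) := by
        rw [← Real.exp_add]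
        congr 1
        push_cast
        ring
      refine le_of_mul_le_mul_right ?_ (by positivity : (0 : ℝ) < n + 1)
      rw [hadd, mul_assoc, hpred, hexp]
      calc _ = ((k - (n + 1)) * Real.exp (2 * ((n + 1) / k))) *
            (Real.exp (n * (n + 1) / k) * ((k - 1).choose n : ℝ)) := by ring
        _ ≤ _ := mul_le_mul hstep ih (by positivity) (by positivity)

/-- For s ≥ 1 and (2s−1.5)²/ln 2 ≤ k < (2s−0.5)²/ln 2, we have
2·C(k − 1, 2s) < C(k + 2s, 2s). -/
theorem choose_strict_ineq_b (s k : ℕ) (hs : 1 ≤ s)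
    (hk1 : (2 * (s : ℝ) - 1.5) ^ 2 / Real.log 2 ≤ (k : ℝ))
    (hk2 : (k : ℝ) < (2 * (s : ℝ) - 0.5) ^ 2 / Real.log 2) :
    2 * Nat.choose (k - 1) (2 * s) < Nat.choose (k + 2 * s) (2 * s) := by
  rcases Nat.lt_or_ge (k - 1) (2 * s) with h | h
  · rw [Nat.choose_eq_zero_of_lt h]
    exact Nat.choose_pos (by omega)
  · have hk : 0 < k := by omega
    have hk0 : (0 : ℝ) < k := by exact_mod_cast hk
    have hs' : (1 : ℝ) ≤ s := by exact_mod_cast hs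
    have hchoose : (0 : ℝ) < (k - 1).choose (2 * s) := by exact_mod_cast Nat.choose_pos h
    have hexp : 2 < Real.exp (((2 * s : ℕ) : ℝ) * (((2 * s : ℕ) : ℝ) + 1) / k) := by
      rw [← Real.log_lt_iff_lt_exp (by norm_num), lt_div_iff₀ hk0]
      rw [lt_div_iff₀ (Real.log_pos (by norm_num))] at hk2
      push_cast
      nlinarith
    have := (mul_lt_mul_of_pos_right hexp hchoose).trans_le
      (exp_mul_choose_pred_le_choose_add hk (2 * s))
    exact_mod_cast this
end

section
/- For all integers s ≥ 1 and k with 4s²/ln 2 ≤ k < (2s + 1)²/ln 2, we have 2·C(k, 2s + 2) < C(k + 2s + 2, 2s + 2). -/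
/-- Shifting the base of a falling factorial by `m` multiplies it by at least `((k + m) / k) ^ j`. -/
lemma Nat.pow_mul_descFactorial_le (k m j : ℕ) :
    (k + m) ^ j * k.descFactorial j ≤ k ^ j * (k + m).descFactorial j := by
  induction j with
  | zero => simp
  | succ j ih =>
    have h : (k + m) * (k - j) ≤ k * (k + m - j) := by
      rcases le_total k j with hkj | hjk
      · simp [Nat.sub_eq_zero_of_le hkj]
      · obtain ⟨d, rfl⟩ := Nat.exists_eq_add_of_le hjk
        rw [show j + d - j = d by omega, show j + d + m - j = d + m by omega]
        nlinarith [Nat.zero_le (j * m)]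
    rw [Nat.descFactorial_succ, Nat.descFactorial_succ]
    calc (k + m) ^ (j + 1) * ((k - j) * k.descFactorial j)
        = ((k + m) * (k - j)) * ((k + m) ^ j * k.descFactorial j) := by ring
      _ ≤ (k * (k + m - j)) * (k ^ j * (k + m).descFactorial j) := Nat.mul_le_mul h ih
      _ = k ^ (j + 1) * ((k + m - j) * (k + m).descFactorial j) := by ring

lemma Nat.pow_mul_choose_le (k m j : ℕ) :
    (k + m) ^ j * k.choose j ≤ k ^ j * (k + m).choose j := by
  have h := Nat.pow_mul_descFactorial_le k m j
  rw [Nat.descFactorial_eq_factorial_mul_choose, Nat.descFactorial_eq_factorial_mul_choose] at h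
  refine Nat.le_of_mul_le_mul_left ?_ j.factorial_pos
  linarith

/-- If `k + n < n ^ 2 / log 2`, then `(1 + n / k) ^ n > 2`. -/
lemma two_mul_pow_lt_add_pow {k n : ℕ} (hk : 0 < k)
    (h : Real.log 2 * ((k : ℝ) + n) < (n : ℝ) ^ 2) : 2 * k ^ n < (k + n) ^ n := by
  have hk' : (0 : ℝ) < k := by exact_mod_cast hk
  have hkn : (0 : ℝ) < (k : ℝ) + n := by positivity
  have hlog : (n : ℝ) / (k + n) ≤ Real.log ((k + n) / k) := by
    have := Real.one_sub_inv_le_log_of_pos (div_pos hkn hk')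
    rwa [inv_div, one_sub_div hkn.ne', add_sub_cancel_left] at this
  have hlt : Real.log 2 < Real.log (((k + n) / k : ℝ) ^ n) := by
    rw [Real.log_pow]
    calc Real.log 2 < (n : ℝ) ^ 2 / (k + n) := (lt_div_iff₀ hkn).2 h
      _ = n * (n / (k + n)) := by ring
      _ ≤ n * Real.log ((k + n) / k) := by gcongr
  have h2 := (Real.log_lt_log_iff two_pos (by positivity)).1 hlt
  rw [div_pow, lt_div_iff₀ (by positivity)] at h2
  exact_mod_cast h2

/-- For s ≥ 1 and 4s²/ln 2 ≤ k < (2s+1)²/ln 2, we have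
2·C(k, 2s+2) < C(k + 2s + 2, 2s + 2). -/
theorem choose_strict_ineq_c (s k : ℕ) (hs : 1 ≤ s)
    (hk1 : 4 * (s : ℝ) ^ 2 / Real.log 2 ≤ (k : ℝ))
    (hk2 : (k : ℝ) < (2 * (s : ℝ) + 1) ^ 2 / Real.log 2) :
    2 * Nat.choose k (2 * s + 2) < Nat.choose (k + 2 * s + 2) (2 * s + 2) := by
  have hl : 0 < Real.log 2 := Real.log_pos one_lt_two
  have hl1 : Real.log 2 < 1 := Real.log_two_lt_d9.trans (by norm_num)
  have hs' : (0 : ℝ) < s := by exact_mod_cast hs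
  have hk : 0 < k := by
    have : (0 : ℝ) < k := lt_of_lt_of_le (by positivity) hk1
    exact_mod_cast this
  have hpow : 2 * k ^ (2 * s + 2) < (k + (2 * s + 2)) ^ (2 * s + 2) := by
    refine two_mul_pow_lt_add_pow hk ?_
    rw [lt_div_iff₀ hl] at hk2
    push_cast
    nlinarith
  rw [add_assoc]
  rcases Nat.eq_zero_or_pos (k.choose (2 * s + 2)) with h0 | hpos
  · rw [h0, mul_zero]
    exact Nat.choose_pos (Nat.le_add_left _ _)
  · refine Nat.lt_of_mul_lt_mul_left (a := k ^ (2 * s + 2)) ?_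
    calc k ^ (2 * s + 2) * (2 * k.choose (2 * s + 2))
        = 2 * k ^ (2 * s + 2) * k.choose (2 * s + 2) := by ring
      _ < (k + (2 * s + 2)) ^ (2 * s + 2) * k.choose (2 * s + 2) :=
        Nat.mul_lt_mul_of_pos_right hpow hpos
      _ ≤ _ := Nat.pow_mul_choose_le _ _ _
end

section
/- For all integers s ≥ 1 and k with (2s − 1)²/ln 2 ≤ k < 4s²/ln 2, we have 2·C(k − 1, 2s) < C(k + 2s + 1, 2s). -/
theorem Nat.choose_mul_add_pow_le (m a n : ℕ) :
    m.choose n * (m + a) ^ n ≤ (m + a).choose n * m ^ n := by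
  have key : m.descFactorial n * (m + a) ^ n ≤ (m + a).descFactorial n * m ^ n := by
    induction n with
    | zero => simp
    | succ n ih =>
      have step : (m - n) * (m + a) ≤ (m + a - n) * m := by
        rcases le_total m n with h | h
        · simp [Nat.sub_eq_zero_of_le h]
        · obtain ⟨d, rfl⟩ := Nat.exists_eq_add_of_le h
          rw [show n + d - n = d by lia, show n + d + a - n = d + a by lia]
          nlinarith [Nat.zero_le (a * n)]
      rw [Nat.descFactorial_succ, Nat.descFactorial_succ, pow_succ, pow_succ]
      calc (m - n) * m.descFactorial n * ((m + a) ^ n * (m + a))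
          = (m - n) * (m + a) * (m.descFactorial n * (m + a) ^ n) := by ring
        _ ≤ (m + a - n) * m * ((m + a).descFactorial n * m ^ n) := Nat.mul_le_mul step ih
        _ = _ := by ring
  rw [Nat.descFactorial_eq_factorial_mul_choose, Nat.descFactorial_eq_factorial_mul_choose,
    mul_assoc, mul_assoc] at key
  exact Nat.le_of_mul_le_mul_left key n.factorial_pos

theorem two_lt_one_add_pow {x : ℝ} (hx : 0 ≤ x) (n : ℕ)
    (h : Real.log 2 < n * (2 * x / (x + 2))) : 2 < (1 + x) ^ n := by
  rw [← Real.log_lt_log_iff (by norm_num) (by positivity), Real.log_pow]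
  exact h.trans_le (by gcongr; exact Real.le_log_one_add_of_nonneg hx)

/-- For s ≥ 1 and (2s−1)²/ln 2 ≤ k < 4s²/ln 2, we have
2·C(k − 1, 2s) < C(k + 2s + 1, 2s). -/
theorem choose_strict_ineq_d (s k : ℕ) (hs : 1 ≤ s)
    (hk1 : (2 * (s : ℝ) - 1) ^ 2 / Real.log 2 ≤ (k : ℝ))
    (hk2 : (k : ℝ) < 4 * (s : ℝ) ^ 2 / Real.log 2) :
    2 * Nat.choose (k - 1) (2 * s) < Nat.choose (k + 2 * s + 1) (2 * s) := by
  have hpos : 0 < Nat.choose (k + 2 * s + 1) (2 * s) := Nat.choose_pos (by lia)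
  rcases Nat.lt_or_ge 1 k with hk | hk
  swap
  · rwa [Nat.choose_eq_zero_of_lt (by lia)]
  obtain ⟨m, rfl⟩ : ∃ m, k = m + 1 := ⟨k - 1, by lia⟩
  have hm : (0 : ℝ) < m := by exact_mod_cast (by lia : 0 < m)
  have hs' : (1 : ℝ) ≤ s := by exact_mod_cast hs
  have hlog : 0 < Real.log 2 := Real.log_pos (by norm_num)
  have hlog1 : Real.log 2 < 1 := Real.log_two_lt_d9.trans (by norm_num)
  have hpow : 2 * m ^ (2 * s) < (m + (2 * s + 2)) ^ (2 * s) := by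
    have h := two_lt_one_add_pow (x := (2 * s + 2) / m) (by positivity) (2 * s) (by
      have hx : ((2 * s : ℕ) : ℝ) * (2 * ((2 * s + 2) / m) / ((2 * s + 2) / m + 2))
          = 4 * s * (s + 1) / (m + 1 + s) := by
        push_cast
        field_simp
        ring
      rw [hx, lt_div_iff₀ (by positivity)]
      rw [lt_div_iff₀ hlog] at hk2
      push_cast at hk2
      nlinarith)
    rw [show (1 : ℝ) + (2 * s + 2) / m = (m + (2 * s + 2)) / m by field_simp, div_pow,
      lt_div_iff₀ (by positivity)] at h
    exact_mod_cast h
  have hle := Nat.choose_mul_add_pow_le m (2 * s + 2) (2 * s)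
  rw [show m + 1 - 1 = m by lia, show m + 1 + 2 * s + 1 = m + (2 * s + 2) by lia] at *
  rcases Nat.eq_zero_or_pos (m.choose (2 * s)) with h0 | h0
  · rwa [h0]
  · refine Nat.lt_of_mul_lt_mul_right (a := m ^ (2 * s)) ?_
    calc 2 * m.choose (2 * s) * m ^ (2 * s) = m.choose (2 * s) * (2 * m ^ (2 * s)) := by ring
      _ < m.choose (2 * s) * (m + (2 * s + 2)) ^ (2 * s) := Nat.mul_lt_mul_of_pos_left hpow h0
      _ ≤ _ := hle
end
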